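/- Fix α, β, γ ∈ K. Let V be the K-vector space with basis {e_i : i ∈ ℤ} ∪ {f_i : i ∈ ℤ}, and let [·,·] be the bilinear bracket on V determined by [e_i,e_j] = 0, [e_i,f_j] = 0 = [f_j,e_i], and [f_i,f_j] = δ_{i,0}(jα+γ)e_{j+1} − δ_{j,0}(iα+γ)e_{i+1} + β( δ_{i,0}f_j − δ_{j,0}f_i ) for all i, j ∈ ℤ. Then this bracket is alternating and satisfies the Jacobi identity, so it makes V an infinite-dimensional Lie algebra over K. -/

import Mathlib

noncomputable section

variable (K : Type*) [Field K]

/-- The `K`-vector space with basis `{eᵢ : i ∈ ℤ} ∪ {fᵢ : i ∈ ℤ}`. -/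
abbrev VV := (ℤ ⊕ ℤ) →₀ K

/-- The basis vector `eᵢ`. -/
def ee (i : ℤ) : VV K := Finsupp.single (Sum.inl i) 1

/-- The basis vector `fᵢ`. -/
def ff (i : ℤ) : VV K := Finsupp.single (Sum.inr i) 1

/-- The bilinear bracket on `V` determined by its values `B` on pairs of basis elements. -/
def vbr (B : ℤ ⊕ ℤ → ℤ ⊕ ℤ → VV K) : VV K →ₗ[K] VV K →ₗ[K] VV K :=
  Finsupp.lsum K fun s => LinearMap.toSpanSingleton K (VV K →ₗ[K] VV K)
    (Finsupp.lsum K fun t => LinearMap.toSpanSingleton K (VV K) (B s t))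

/-- The values on basis elements of the bracket of Statement 19 (arising from the cobracket
`δ(Lₙ) = (nα+γ)(I₀⊗Iₙ − Iₙ⊗I₀)`, `δ(Iₙ) = β(I₀⊗Iₙ − Iₙ⊗I₀)`). -/
def B19 (α β γ : K) : ℤ ⊕ ℤ → ℤ ⊕ ℤ → VV K
  | Sum.inl _, Sum.inl _ => 0
  | Sum.inl _, Sum.inr _ => 0
  | Sum.inr _, Sum.inl _ => 0
  | Sum.inr i, Sum.inr j =>
      (if i = 0 then (j : K) * α + γ else 0) • ee K (j + 1)
      - (if j = 0 then (i : K) * α + γ else 0) • ee K (i + 1)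
      + β • ((if i = 0 then (1 : K) else 0) • ff K j
          - (if j = 0 then (1 : K) else 0) • ff K i)

/-- The linear form `φ` with `φ(eᵢ) = 0` and `φ(fᵢ) = δ_{i,0}`. -/
def coordFZero : VV K →ₗ[K] K := Finsupp.lapply (Sum.inr 0)

/-- The endomorphism `D` with `D(eⱼ) = 0` and `D(fⱼ) = (jα+γ)e_{j+1} + βfⱼ`. -/
def adFZero (α β γ : K) : VV K →ₗ[K] VV K :=
  Finsupp.lsum K fun t => LinearMap.toSpanSingleton K (VV K)
    (Sum.elim (fun _ => 0) (fun j : ℤ => ((j : K) * α + γ) • ee K (j + 1) + β • ff K j) t)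

theorem vbr_single_single (B : ℤ ⊕ ℤ → ℤ ⊕ ℤ → VV K) (s t : ℤ ⊕ ℤ) :
    vbr K B (Finsupp.single s 1) (Finsupp.single t 1) = B s t := by
  simp [vbr]

theorem adFZero_single (α β γ : K) (t : ℤ ⊕ ℤ) :
    adFZero K α β γ (Finsupp.single t 1) =
      Sum.elim (fun _ => 0) (fun j : ℤ => ((j : K) * α + γ) • ee K (j + 1) + β • ff K j) t := by
  simp [adFZero]

/-- The bracket has the form `[u,v] = φ(u)D(v) − φ(v)D(u)`. -/
theorem vbr_B19_apply (α β γ : K) (u v : VV K) :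
    vbr K (B19 K α β γ) u v =
      coordFZero K u • adFZero K α β γ v - coordFZero K v • adFZero K α β γ u := by
  have h : vbr K (B19 K α β γ) +
        ((LinearMap.lsmul K (VV K)).compl₁₂ (coordFZero K) (adFZero K α β γ)).flip =
      (LinearMap.lsmul K (VV K)).compl₁₂ (coordFZero K) (adFZero K α β γ) := by
    ext s t : 4
    simp only [LinearMap.comp_apply, Finsupp.lsingle_apply, LinearMap.add_apply,
      LinearMap.flip_apply, LinearMap.compl₁₂_apply, LinearMap.lsmul_apply,
      vbr_single_single, adFZero_single]
    rcases s with i | i <;> rcases t with j | j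
    · simp [B19]
    · simp [B19, coordFZero]
    · simp [B19, coordFZero]
    · by_cases hi : i = 0 <;> by_cases hj : j = 0 <;>
        simp [B19, coordFZero, hi, hj, sub_eq_add_neg]
      abel
  exact eq_sub_of_add_eq (LinearMap.congr_fun (LinearMap.congr_fun h u) v)

theorem coordFZero_adFZero (α β γ : K) (v : VV K) :
    coordFZero K (adFZero K α β γ v) = β * coordFZero K v := by
  have h : coordFZero K ∘ₗ adFZero K α β γ = β • coordFZero K := by
    ext t : 2
    simp only [LinearMap.comp_apply, Finsupp.lsingle_apply, LinearMap.smul_apply, adFZero_single]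
    rcases t with j | j <;> simp [coordFZero, ee, ff, Finsupp.single_apply]
  exact LinearMap.congr_fun h v

/-- the bilinear bracket on the space `V` with basis `{eᵢ} ∪ {fᵢ}` given by
`[eᵢ,eⱼ] = 0`, `[eᵢ,fⱼ] = 0 = [fⱼ,eᵢ]`, and
`[fᵢ,fⱼ] = δ_{i,0}(jα+γ)e_{j+1} − δ_{j,0}(iα+γ)e_{i+1} + β(δ_{i,0}fⱼ − δ_{j,0}fᵢ)`
is alternating and satisfies the Jacobi identity, so it makes `V` an infinite-dimensional
Lie algebra. -/
theorem statement19 [CharZero K] (α β γ : K) :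
    (∀ u : VV K, vbr K (B19 K α β γ) u u = 0) ∧
    (∀ u v w : VV K,
      vbr K (B19 K α β γ) (vbr K (B19 K α β γ) u v) w
        + vbr K (B19 K α β γ) (vbr K (B19 K α β γ) v w) u
        + vbr K (B19 K α β γ) (vbr K (B19 K α β γ) w u) v = 0) ∧
    ¬ FiniteDimensional K (VV K) := by
  refine ⟨fun u => ?_, fun u v w => ?_, fun h => ?_⟩
  · rw [vbr_B19_apply, sub_self]
  · simp only [vbr_B19_apply]
    simp only [map_sub, map_smul, coordFZero_adFZero, smul_eq_mul]
    module
  · exact not_finite_iff_infinite.mpr inferInstance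
      (Module.Finite.finite_basis (Finsupp.basisSingleOne (R := K) (ι := ℤ ⊕ ℤ)))

end
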